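/- (Theorem 2: integrated autocorrelation formula for the simple cut-off.) Let 0 < ε ≤ δ with c_δ > 0 and c_ε > 0, and let f: T → ℝ satisfy ∫ f² dπ_ε < ∞. Set h(θ,y) = 1{d(y,y*) ≤ ε} f(θ), w̄(θ) = L_ε(θ)/L_δ(θ), f_w = f·w̄. Assume Var_{π̃_δ}(h) > 0, define ρ_k = [∫ h (P̃_δ^k h) dπ̃_δ − (∫ h dπ̃_δ)²]/Var_{π̃_δ}(h) and (when Var_{π_δ}(f_w) > 0) ρ̌_k = [∫ f_w (Ṗ_δ^k f_w) dπ_δ − (∫ f_w dπ_δ)²]/Var_{π_δ}(f_w), and assume Σ_{k≥1} |ρ_k| < ∞ and Σ_{k≥1} |ρ̌_k| < ∞. Assume further r_δ(θ) < 1 for π_δ-a.e. θ and ∫ w̄(1−w̄) (r_δ/(1−r_δ)) f² dπ_δ < ∞. Then, with τ = 1 + 2Σ_{k≥1} ρ_k and τ̌ = 1 + 2Σ_{k≥1} ρ̌_k, τ − 1 = [ (τ̌ − 1)·Var_{π_δ}(f_w) + 2 ∫ w̄(θ)(1 − w̄(θ)) (r_δ(θ)/(1 − r_δ(θ))) f(θ)²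 π_δ(dθ) ] / [ Var_{π_δ}(f_w) + ∫ w̄(θ)(1 − w̄(θ)) f(θ)² π_δ(dθ) ] (where, if Var_{π_δ}(f_w) = 0, the term (τ̌−1)·Var_{π_δ}(f_w) is interpreted as 0). -/

import Mathlib

open MeasureTheory ProbabilityTheory
open scoped ENNReal

noncomputable section

namespace ABCsimple

variable {T Y : Type*} [MeasurableSpace T] [MeasurableSpace Y]

/-- Simple cut-off kernel value `K_ε(y) = 1{d(y,y*) ≤ ε}`. -/
def K (d : Y → ℝ) (ε : ℝ) (y : Y) : ℝ := if d y ≤ ε then 1 else 0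

/-- ABC likelihood `L_ε(θ) = ∫ K_ε(y) g(θ,dy)`. -/
def L (g : Kernel T Y) (d : Y → ℝ) (ε : ℝ) (θ : T) : ℝ := ∫ y, K d ε y ∂(g θ)

/-- Normalising constant `c_ε = ∫ pr(θ) L_ε(θ) ν(dθ)`. -/
def c (ν : Measure T) (pr : T → ℝ) (g : Kernel T Y) (d : Y → ℝ) (ε : ℝ) : ℝ :=
  ∫ θ, pr θ * L g d ε θ ∂ν

/-- ABC posterior `π_ε(dθ) = c_ε⁻¹ pr(θ) L_ε(θ) ν(dθ)`. -/
def piPost (ν : Measure T) (pr : T → ℝ) (g : Kernel T Y) (d : Y → ℝ) (ε : ℝ) : Measure T :=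
  (ENNReal.ofReal (c ν pr g d ε))⁻¹ •
    ν.withDensity (fun θ => ENNReal.ofReal (pr θ * L g d ε θ))

/-- Joint ABC target `π̃_ε(dθ,dy) = c_ε⁻¹ pr(θ) K_ε(y) g(θ,dy) ν(dθ)`. -/
def piJoint (ν : Measure T) (pr : T → ℝ) (g : Kernel T Y) (d : Y → ℝ) (ε : ℝ) :
    Measure (T × Y) :=
  (ENNReal.ofReal (c ν pr g d ε))⁻¹ •
    (ν ⊗ₘ g).withDensity (fun p => ENNReal.ofReal (pr p.1 * K d ε p.2))

/-- `w̄(θ) = L_ε(θ)/L_δ(θ)`. -/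
def wbar (g : Kernel T Y) (d : Y → ℝ) (δ ε : ℝ) (θ : T) : ℝ := L g d ε θ / L g d δ θ


/-- Metropolis–Hastings acceptance probability of ABC-MCMC(δ),
`α_δ(θ,y;θ',y') = min{1, pr(θ')q(θ',θ)K_δ(y') / (pr(θ)q(θ,θ')K_δ(y))}`. -/
def accept (pr : T → ℝ) (q : T → T → ℝ) (d : Y → ℝ) (δ : ℝ) (p p' : T × Y) : ℝ :=
  min 1 (pr p'.1 * q p'.1 p.1 * K d δ p'.2 / (pr p.1 * q p.1 p'.1 * K d δ p.2))

/-- The transition operator `P̃_δ` of ABC-MCMC(δ) acting on functions. -/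
def MHop (ν : Measure T) (g : Kernel T Y) (pr : T → ℝ) (q : T → T → ℝ) (d : Y → ℝ) (δ : ℝ)
    (h : T × Y → ℝ) : T × Y → ℝ :=
  fun p =>
    (∫ ϑ, q p.1 ϑ * ∫ y', accept pr q d δ p (ϑ, y') * h (ϑ, y') ∂(g ϑ) ∂ν)
      + (1 - ∫ ϑ, q p.1 ϑ * ∫ y', accept pr q d δ p (ϑ, y') ∂(g ϑ) ∂ν) * h p

/-- `α̇(θ,ϑ) = min{1, pr(ϑ)q(ϑ,θ)/(pr(θ)q(θ,ϑ))}`. -/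
def alphadot (pr : T → ℝ) (q : T → T → ℝ) (θ ϑ : T) : ℝ :=
  min 1 (pr ϑ * q ϑ θ / (pr θ * q θ ϑ))

/-- Rejection probability `r_δ(θ) = 1 - ∫ q(θ,ϑ) α̇(θ,ϑ) L_δ(ϑ) ν(dϑ)`. -/
def rej (ν : Measure T) (g : Kernel T Y) (pr : T → ℝ) (q : T → T → ℝ) (d : Y → ℝ) (δ : ℝ)
    (θ : T) : ℝ :=
  1 - ∫ ϑ, q θ ϑ * alphadot pr q θ ϑ * L g d δ ϑ ∂ν

/-- The marginal θ-chain operator `Ṗ_δ` acting on functions. -/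
def Pdotop (ν : Measure T) (g : Kernel T Y) (pr : T → ℝ) (q : T → T → ℝ) (d : Y → ℝ) (δ : ℝ)
    (f : T → ℝ) : T → ℝ :=
  fun θ => (∫ ϑ, q θ ϑ * alphadot pr q θ ϑ * L g d δ ϑ * f ϑ ∂ν)
    + rej ν g pr q d δ θ * f θ

end ABCsimple

namespace ABCsimple

section CutOff

variable {Y : Type*} {d : Y → ℝ} {δ ε : ℝ}

lemma K_nonneg (y : Y) : 0 ≤ K d ε y := by unfold K; split_ifs <;> simp

lemma K_le_one (y : Y) : K d ε y ≤ 1 := by unfold K; split_ifs <;> simp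

lemma K_mul_K (h : ε ≤ δ) (y : Y) : K d δ y * K d ε y = K d ε y := by
  unfold K
  split_ifs with h₁ h₂
  · simp
  · simp
  · exact absurd (‹d y ≤ ε›.trans h) h₁
  · simp

lemma K_eq_zero_or_one (y : Y) : K d ε y = 0 ∨ K d ε y = 1 := by
  unfold K; split_ifs <;> simp

variable [MeasurableSpace Y]

lemma measurable_K (hd : Measurable d) : Measurable (K d ε) :=
  Measurable.ite (measurableSet_le hd measurable_const) measurable_const measurable_const

lemma integrable_K (hd : Measurable d) (μ : Measure Y) [IsFiniteMeasure μ] :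
    Integrable (K d ε) μ :=
  Integrable.of_bound (measurable_K hd).aestronglyMeasurable 1
    (.of_forall fun y => by rw [Real.norm_of_nonneg (K_nonneg y)]; exact K_le_one y)

end CutOff

section Acceptance

variable {T Y : Type*} {pr : T → ℝ} {q : T → T → ℝ}

lemma alphadot_nonneg (hpr0 : ∀ θ, 0 ≤ pr θ) (hq0 : ∀ θ ϑ, 0 ≤ q θ ϑ) (θ ϑ : T) :
    0 ≤ alphadot pr q θ ϑ :=
  le_min zero_le_one
    (div_nonneg (mul_nonneg (hpr0 _) (hq0 _ _)) (mul_nonneg (hpr0 _) (hq0 _ _)))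

lemma pr_mul_q_mul_alphadot (hpr0 : ∀ θ, 0 ≤ pr θ) (hq0 : ∀ θ ϑ, 0 ≤ q θ ϑ) (θ ϑ : T) :
    pr θ * q θ ϑ * alphadot pr q θ ϑ = min (pr θ * q θ ϑ) (pr ϑ * q ϑ θ) := by
  rcases eq_or_ne (pr θ * q θ ϑ) 0 with h | h
  · rw [h, zero_mul, min_eq_left (mul_nonneg (hpr0 _) (hq0 _ _))]
  · rw [alphadot, mul_min_of_nonneg _ _ (mul_nonneg (hpr0 _) (hq0 _ _)), mul_one,
      mul_div_cancel₀ _ h]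

lemma accept_of_K_eq_one {d : Y → ℝ} {δ : ℝ} {p : T × Y} (hp : K d δ p.2 = 1) (ϑ : T) (y : Y) :
    accept pr q d δ p (ϑ, y) = alphadot pr q p.1 ϑ * K d δ y := by
  rcases K_eq_zero_or_one (d := d) (ε := δ) y with h | h <;> simp [accept, alphadot, hp, h]

end Acceptance

variable {T Y : Type*} [MeasurableSpace T] [MeasurableSpace Y]

lemma measurable_K_snd {d : Y → ℝ} {ε : ℝ} (hd : Measurable d) :
    Measurable fun p : T × Y => K d ε p.2 :=
  (measurable_K hd).comp measurable_snd

section Likelihood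

variable {g : Kernel T Y} {d : Y → ℝ} {δ ε : ℝ}

lemma L_nonneg (θ : T) : 0 ≤ L g d ε θ := integral_nonneg fun y => K_nonneg y

lemma wbar_nonneg (θ : T) : 0 ≤ wbar g d δ ε θ := div_nonneg (L_nonneg θ) (L_nonneg θ)

variable [IsMarkovKernel g]

lemma L_le_one (hd : Measurable d) (θ : T) : L g d ε θ ≤ 1 :=
  (integral_mono (integrable_K hd _) (integrable_const 1) fun y => K_le_one y).trans
    (by simp)

lemma L_mono (hd : Measurable d) (h : ε ≤ δ) (θ : T) : L g d ε θ ≤ L g d δ θ :=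
  integral_mono (integrable_K hd _) (integrable_K hd _) fun y => by
    rw [← K_mul_K h y]
    exact mul_le_of_le_one_right (K_nonneg y) (K_le_one y)

lemma measurable_L (hd : Measurable d) : Measurable (L g d ε) :=
  ((measurable_K_snd hd).stronglyMeasurable.integral_kernel_prod_right'
    (κ := g)).measurable

lemma ofReal_L (hd : Measurable d) (θ : T) :
    ENNReal.ofReal (L g d ε θ) = ∫⁻ y, ENNReal.ofReal (K d ε y) ∂(g θ) :=
  ofReal_integral_eq_lintegral_ofReal (integrable_K hd _) (.of_forall fun y => K_nonneg y)

lemma wbar_le_one (hd : Measurable d) (h : ε ≤ δ) (θ : T) : wbar g d δ ε θ ≤ 1 :=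
  div_le_one_of_le₀ (L_mono hd h θ) (L_nonneg θ)

lemma measurable_wbar (hd : Measurable d) : Measurable (wbar g d δ ε) :=
  (measurable_L hd).div (measurable_L hd)

lemma L_mul_wbar (hd : Measurable d) (h : ε ≤ δ) (θ : T) :
    L g d δ θ * wbar g d δ ε θ = L g d ε θ := by
  rcases eq_or_ne (L g d δ θ) 0 with h0 | h0
  · rw [h0, zero_mul]
    exact le_antisymm (L_nonneg θ) (h0 ▸ L_mono hd h θ)
  · exact mul_div_cancel₀ _ h0

end Likelihood

section Posterior

variable {ν : Measure T} {pr : T → ℝ} {g : Kernel T Y} {d : Y → ℝ} {δ ε : ℝ}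

lemma ae_piPost_pos (hpr : Measurable pr) (hL : Measurable (L g d δ)) :
    ∀ᵐ θ ∂(piPost ν pr g d δ), 0 < pr θ * L g d δ θ := by
  refine Measure.ae_smul_measure ?_ _
  rw [ae_withDensity_iff (hpr.fun_mul hL).ennreal_ofReal]
  exact .of_forall fun θ hθ => by simpa using hθ

lemma ae_piJoint_pos (hpr : Measurable pr) (hd : Measurable d) :
    ∀ᵐ p ∂(piJoint ν pr g d δ), 0 < pr p.1 * K d δ p.2 := by
  refine Measure.ae_smul_measure ?_ _
  rw [ae_withDensity_iff
    ((hpr.fun_comp measurable_fst).fun_mul (measurable_K_snd hd)).ennreal_ofReal]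
  exact .of_forall fun p hp => by simpa using hp

lemma lintegral_pr_mul_L (hpr0 : ∀ θ, 0 ≤ pr θ) (hc : 0 < c ν pr g d δ) :
    ∫⁻ θ, ENNReal.ofReal (pr θ * L g d δ θ) ∂ν = ENNReal.ofReal (c ν pr g d δ) :=
  (ofReal_integral_eq_lintegral_ofReal (Integrable.of_integral_ne_zero hc.ne')
    (.of_forall fun θ => mul_nonneg (hpr0 θ) (L_nonneg θ))).symm

lemma isProbabilityMeasure_piPost (hpr0 : ∀ θ, 0 ≤ pr θ) (hc : 0 < c ν pr g d δ) :
    IsProbabilityMeasure (piPost ν pr g d δ) := ⟨by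
  rw [piPost, Measure.smul_apply, withDensity_apply _ .univ, Measure.restrict_univ,
    lintegral_pr_mul_L hpr0 hc, smul_eq_mul,
    ENNReal.inv_mul_cancel (by simpa using hc) ENNReal.ofReal_ne_top]⟩

variable [IsMarkovKernel g]

lemma withDensity_wbar_piPost (hpr : Measurable pr) (hpr0 : ∀ θ, 0 ≤ pr θ) (hd : Measurable d)
    (h : ε ≤ δ) :
    (piPost ν pr g d δ).withDensity (fun θ => ENNReal.ofReal (wbar g d δ ε θ)) =
      (ENNReal.ofReal (c ν pr g d δ))⁻¹ •
        ν.withDensity (fun θ => ENNReal.ofReal (pr θ * L g d ε θ)) := by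
  rw [piPost, withDensity_smul_measure, ← withDensity_mul _
    (hpr.fun_mul (measurable_L hd)).ennreal_ofReal (measurable_wbar hd).ennreal_ofReal]
  congr 2
  ext θ
  rw [Pi.mul_apply, ← ENNReal.ofReal_mul (mul_nonneg (hpr0 θ) (L_nonneg θ)), mul_assoc,
    L_mul_wbar hd h]

lemma map_fst_withDensity_piJoint [SFinite ν] (hpr : Measurable pr) (hpr0 : ∀ θ, 0 ≤ pr θ)
    (hd : Measurable d) (h : ε ≤ δ) :
    ((piJoint ν pr g d δ).withDensity (fun p => ENNReal.ofReal (K d ε p.2))).map Prod.fst =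
      (ENNReal.ofReal (c ν pr g d δ))⁻¹ •
        ν.withDensity (fun θ => ENNReal.ofReal (pr θ * L g d ε θ)) := by
  have hprm : Measurable fun p : T × Y => pr p.1 := hpr.fun_comp measurable_fst
  rw [piJoint, withDensity_smul_measure, ← withDensity_mul _
    (hprm.fun_mul (measurable_K_snd hd)).ennreal_ofReal (measurable_K_snd hd).ennreal_ofReal,
    Measure.map_smul]
  congr 1
  ext s hs
  rw [Measure.map_apply measurable_fst hs, withDensity_apply _ (measurable_fst hs),
    withDensity_apply _ hs, ← Set.prod_univ, Measure.setLIntegral_compProd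
      ((hprm.fun_mul (measurable_K_snd hd)).ennreal_ofReal.mul
        (measurable_K_snd hd).ennreal_ofReal) hs .univ]
  refine lintegral_congr fun θ => ?_
  have hθ : ∀ y, ENNReal.ofReal (pr θ * K d δ y) * ENNReal.ofReal (K d ε y)
      = ENNReal.ofReal (pr θ) * ENNReal.ofReal (K d ε y) := fun y => by
    rw [← ENNReal.ofReal_mul (mul_nonneg (hpr0 θ) (K_nonneg y)), mul_assoc, K_mul_K h,
      ENNReal.ofReal_mul (hpr0 θ)]
  simp only [Pi.mul_apply, hθ, Measure.restrict_univ]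
  rw [lintegral_const_mul _ (measurable_K hd).ennreal_ofReal, ← ofReal_L hd,
    ENNReal.ofReal_mul (hpr0 θ)]

/-- Integrating out the data variable turns the weight `K_ε` into `w̄`. -/
lemma map_fst_withDensity_piJoint_eq [SFinite ν] (hpr : Measurable pr) (hpr0 : ∀ θ, 0 ≤ pr θ)
    (hd : Measurable d) (h : ε ≤ δ) :
    ((piJoint ν pr g d δ).withDensity (fun p => ENNReal.ofReal (K d ε p.2))).map Prod.fst =
      (piPost ν pr g d δ).withDensity (fun θ => ENNReal.ofReal (wbar g d δ ε θ)) := by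
  rw [map_fst_withDensity_piJoint hpr hpr0 hd h, withDensity_wbar_piPost hpr hpr0 hd h]

lemma integral_K_mul_piJoint [SFinite ν] (hpr : Measurable pr) (hpr0 : ∀ θ, 0 ≤ pr θ)
    (hd : Measurable d) (h : ε ≤ δ) {G : T → ℝ} (hG : Measurable G) :
    ∫ p, K d ε p.2 * G p.1 ∂(piJoint ν pr g d δ) =
      ∫ θ, wbar g d δ ε θ * G θ ∂(piPost ν pr g d δ) := by
  have key := congrArg (fun m => ∫ θ, G θ ∂m)
    (map_fst_withDensity_piJoint_eq (ν := ν) (g := g) hpr hpr0 hd h)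
  rw [integral_map measurable_fst.aemeasurable hG.aestronglyMeasurable,
    integral_withDensity_eq_integral_toReal_smul
      (measurable_K_snd hd).ennreal_ofReal (by simp),
    integral_withDensity_eq_integral_toReal_smul (measurable_wbar hd).ennreal_ofReal
      (by simp)] at key
  simpa only [ENNReal.toReal_ofReal, K_nonneg, wbar_nonneg, smul_eq_mul] using key

lemma integrable_K_mul_piJoint_iff [SFinite ν] (hpr : Measurable pr) (hpr0 : ∀ θ, 0 ≤ pr θ)
    (hd : Measurable d) (h : ε ≤ δ) {G : T → ℝ} (hG : Measurable G) :
    Integrable (fun p => K d ε p.2 * G p.1) (piJoint ν pr g d δ) ↔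
      Integrable (fun θ => wbar g d δ ε θ * G θ) (piPost ν pr g d δ) := by
  have key := congrArg (fun m => Integrable G m)
    (map_fst_withDensity_piJoint_eq (ν := ν) (g := g) hpr hpr0 hd h)
  rw [integrable_map_measure hG.aestronglyMeasurable measurable_fst.aemeasurable,
    integrable_withDensity_iff_integrable_smul'
      (measurable_K_snd hd).ennreal_ofReal (by simp),
    integrable_withDensity_iff_integrable_smul' (measurable_wbar hd).ennreal_ofReal
      (by simp)] at key
  simpa only [ENNReal.toReal_ofReal, K_nonneg, wbar_nonneg, smul_eq_mul, Function.comp_apply,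
    eq_iff_iff] using key

lemma isProbabilityMeasure_piJoint [SFinite ν] (hpr : Measurable pr) (hpr0 : ∀ θ, 0 ≤ pr θ)
    (hd : Measurable d) (hc : 0 < c ν pr g d δ) :
    IsProbabilityMeasure (piJoint ν pr g d δ) := ⟨by
  have h₁ : (piJoint ν pr g d δ).withDensity (fun p => ENNReal.ofReal (K d δ p.2)) =
      piJoint ν pr g d δ := by
    conv_rhs => rw [← withDensity_one (μ := piJoint ν pr g d δ)]
    refine withDensity_congr_ae ?_
    filter_upwards [ae_piJoint_pos hpr hd] with p hp
    rcases K_eq_zero_or_one (d := d) (ε := δ) p.2 with h | h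
    · simp [h] at hp
    · simp [h]
  have h₂ := map_fst_withDensity_piJoint (ν := ν) (g := g) (δ := δ) hpr hpr0 hd le_rfl
  rw [h₁] at h₂
  have h₃ := (isProbabilityMeasure_piPost hpr0 hc).measure_univ
  rwa [piPost, ← h₂, Measure.map_apply measurable_fst .univ, Set.preimage_univ] at h₃⟩

end Posterior

section MetropolisHastings

/-- Density with respect to `ν` of the accepted moves of the marginal chain. -/
def moveDensity (g : Kernel T Y) (pr : T → ℝ) (q : T → T → ℝ) (d : Y → ℝ) (δ : ℝ) (θ ϑ : T) : ℝ :=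
  q θ ϑ * alphadot pr q θ ϑ * L g d δ ϑ

variable {pr : T → ℝ} {q : T → T → ℝ} {g : Kernel T Y} {d : Y → ℝ} {δ ε : ℝ}

lemma moveDensity_nonneg (hpr0 : ∀ θ, 0 ≤ pr θ) (hq0 : ∀ θ ϑ, 0 ≤ q θ ϑ) (θ ϑ : T) :
    0 ≤ moveDensity g pr q d δ θ ϑ :=
  mul_nonneg (mul_nonneg (hq0 _ _) (alphadot_nonneg hpr0 hq0 _ _)) (L_nonneg _)

/-- Detailed balance for the marginal chain. -/
lemma detailed_balance (hpr0 : ∀ θ, 0 ≤ pr θ) (hq0 : ∀ θ ϑ, 0 ≤ q θ ϑ) (θ ϑ : T) :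
    pr θ * L g d δ θ * moveDensity g pr q d δ θ ϑ =
      pr ϑ * L g d δ ϑ * moveDensity g pr q d δ ϑ θ := by
  have h₁ := pr_mul_q_mul_alphadot hpr0 hq0 θ ϑ
  have h₂ := pr_mul_q_mul_alphadot hpr0 hq0 ϑ θ
  rw [min_comm, ← h₁] at h₂
  unfold moveDensity
  linear_combination (-(L g d δ θ * L g d δ ϑ)) * h₂

variable {ν : Measure T}

lemma MHop_of_K_eq_one {u : T × Y → ℝ} {v : T → ℝ}
    (huv : ∀ ϑ, ∫ y, K d δ y * u (ϑ, y) ∂(g ϑ) = L g d δ ϑ * v ϑ) {p : T × Y}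
    (hp : K d δ p.2 = 1) :
    MHop ν g pr q d δ u p =
      (∫ ϑ, moveDensity g pr q d δ p.1 ϑ * v ϑ ∂ν) + rej ν g pr q d δ p.1 * u p := by
  simp only [MHop, accept_of_K_eq_one hp, mul_assoc, integral_const_mul, huv, rej, moveDensity, L]

lemma moveDensity_eq_zero {θ ϑ : T} (h : pr ϑ * L g d δ ϑ = 0) :
    moveDensity g pr q d δ θ ϑ = 0 := by
  rcases mul_eq_zero.1 h with h | h <;> simp [moveDensity, alphadot, h]

lemma integral_moveDensity_eq (θ : T) :
    ∫ ϑ, moveDensity g pr q d δ θ ϑ ∂ν = 1 - rej ν g pr q d δ θ := by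
  simp [rej, moveDensity]

lemma rej_le_one (hpr0 : ∀ θ, 0 ≤ pr θ) (hq0 : ∀ θ ϑ, 0 ≤ q θ ϑ) (θ : T) :
    rej ν g pr q d δ θ ≤ 1 :=
  sub_le_self _ (integral_nonneg fun ϑ => moveDensity_nonneg hpr0 hq0 θ ϑ)

variable [IsMarkovKernel g]

lemma moveDensity_le (hpr0 : ∀ θ, 0 ≤ pr θ) (hq0 : ∀ θ ϑ, 0 ≤ q θ ϑ) (hd : Measurable d)
    (θ ϑ : T) : moveDensity g pr q d δ θ ϑ ≤ q θ ϑ :=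
  (mul_le_of_le_one_right (mul_nonneg (hq0 _ _) (alphadot_nonneg hpr0 hq0 _ _))
    (L_le_one hd _)).trans (mul_le_of_le_one_right (hq0 _ _) (min_le_left _ _))

lemma measurable_moveDensity (hpr : Measurable pr) (hq : Measurable fun p : T × T => q p.1 p.2)
    (hd : Measurable d) : Measurable fun p : T × T => moveDensity g pr q d δ p.1 p.2 := by
  have hL : Measurable (L g d δ) := measurable_L hd
  have hq' : Measurable fun p : T × T => q p.2 p.1 := hq.comp measurable_swap
  unfold moveDensity alphadot
  fun_prop

/-- On states accepted by the cut-off, iterates of the joint chain started at `K_ε f` reduce to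
iterates of the marginal chain started at `f w̄`. -/
lemma MHop_iterate (hd : Measurable d) (h : ε ≤ δ) (f : T → ℝ) (k : ℕ) {p : T × Y}
    (hp : K d δ p.2 = 1) :
    (MHop ν g pr q d δ)^[k] (fun p' => K d ε p'.2 * f p'.1) p =
      (Pdotop ν g pr q d δ)^[k] (fun ϑ => f ϑ * wbar g d δ ε ϑ) p.1 +
        rej ν g pr q d δ p.1 ^ k * (K d ε p.2 * f p.1 - f p.1 * wbar g d δ ε p.1) := by
  induction k generalizing p with
  | zero => simp
  | succ k ih =>
    rw [Function.iterate_succ_apply', MHop_of_K_eq_one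
      (v := (Pdotop ν g pr q d δ)^[k] (fun ϑ => f ϑ * wbar g d δ ε ϑ)) ?_ hp,
      Function.iterate_succ_apply', ih hp]
    · simp only [Pdotop, moveDensity]
      ring
    · intro ϑ
      set A := (Pdotop ν g pr q d δ)^[k] (fun ϑ => f ϑ * wbar g d δ ε ϑ) ϑ
      set R := rej ν g pr q d δ ϑ ^ k
      have hpt : ∀ y, K d δ y *
          (MHop ν g pr q d δ)^[k] (fun p' => K d ε p'.2 * f p'.1) (ϑ, y) =
            (A - R * (f ϑ * wbar g d δ ε ϑ)) * K d δ y + R * f ϑ * K d ε y := fun y => by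
        rcases K_eq_zero_or_one (d := d) (ε := δ) y with h0 | h1
        · have := K_mul_K (d := d) h y
          rw [h0, zero_mul] at this
          simp [h0, ← this]
        · rw [ih (p := (ϑ, y)) h1, h1]
          ring
      simp only [hpt]
      rw [integral_add ((integrable_K hd _).const_mul _) ((integrable_K hd _).const_mul _),
        integral_const_mul, integral_const_mul]
      change _ * L g d δ ϑ + _ * L g d ε ϑ = _
      rw [← L_mul_wbar hd h]
      ring

lemma integrable_moveDensity (hpr : Measurable pr) (hpr0 : ∀ θ, 0 ≤ pr θ)
    (hq : Measurable fun p : T × T => q p.1 p.2) (hq0 : ∀ θ ϑ, 0 ≤ q θ ϑ)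
    (hq1 : ∀ θ, ∫ ϑ, q θ ϑ ∂ν = 1) (hd : Measurable d) (θ : T) :
    Integrable (moveDensity g pr q d δ θ) ν :=
  (Integrable.of_integral_ne_zero (by rw [hq1 θ]; exact one_ne_zero)).mono'
    ((measurable_moveDensity hpr hq hd).of_uncurry_left (f := moveDensity g pr q d δ)
      (x := θ)).aestronglyMeasurable
    (.of_forall fun ϑ => by
      rw [Real.norm_of_nonneg (moveDensity_nonneg hpr0 hq0 θ ϑ)]
      exact moveDensity_le hpr0 hq0 hd θ ϑ)

lemma rej_nonneg (hpr : Measurable pr) (hpr0 : ∀ θ, 0 ≤ pr θ)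
    (hq : Measurable fun p : T × T => q p.1 p.2) (hq0 : ∀ θ ϑ, 0 ≤ q θ ϑ)
    (hq1 : ∀ θ, ∫ ϑ, q θ ϑ ∂ν = 1) (hd : Measurable d) (θ : T) : 0 ≤ rej ν g pr q d δ θ := by
  have := integral_mono (integrable_moveDensity (g := g) (δ := δ) hpr hpr0 hq hq0 hq1 hd θ)
    (Integrable.of_integral_ne_zero (by rw [hq1 θ]; exact one_ne_zero))
    (moveDensity_le hpr0 hq0 hd θ)
  rw [integral_moveDensity_eq, hq1] at this
  linarith

lemma lintegral_moveDensity_le (hpr : Measurable pr) (hpr0 : ∀ θ, 0 ≤ pr θ)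
    (hq : Measurable fun p : T × T => q p.1 p.2) (hq0 : ∀ θ ϑ, 0 ≤ q θ ϑ)
    (hq1 : ∀ θ, ∫ ϑ, q θ ϑ ∂ν = 1) (hd : Measurable d) (θ : T) :
    ∫⁻ ϑ, ENNReal.ofReal (moveDensity g pr q d δ θ ϑ) ∂ν ≤ 1 := by
  rw [← ofReal_integral_eq_lintegral_ofReal
    (integrable_moveDensity hpr hpr0 hq hq0 hq1 hd θ)
    (.of_forall fun ϑ => moveDensity_nonneg hpr0 hq0 θ ϑ), integral_moveDensity_eq,
    ENNReal.ofReal_le_one]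
  linarith [rej_nonneg (g := g) (δ := δ) hpr hpr0 hq hq0 hq1 hd θ]

lemma measurable_integral_moveDensity_mul [SFinite ν] (hpr : Measurable pr)
    (hq : Measurable fun p : T × T => q p.1 p.2) (hd : Measurable d) {v : T → ℝ}
    (hv : Measurable v) : Measurable fun θ => ∫ ϑ, moveDensity g pr q d δ θ ϑ * v ϑ ∂ν :=
  (((measurable_moveDensity hpr hq hd).mul
    (hv.comp measurable_snd)).stronglyMeasurable.integral_prod_right').measurable

lemma measurable_rej [SFinite ν] (hpr : Measurable pr)
    (hq : Measurable fun p : T × T => q p.1 p.2) (hd : Measurable d) :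
    Measurable (rej ν g pr q d δ) :=
  measurable_const.sub
    (measurable_moveDensity hpr hq hd).stronglyMeasurable.integral_prod_right'.measurable

lemma measurable_Pdotop [SFinite ν] (hpr : Measurable pr)
    (hq : Measurable fun p : T × T => q p.1 p.2) (hd : Measurable d) {v : T → ℝ}
    (hv : Measurable v) : Measurable (Pdotop ν g pr q d δ v) :=
  (measurable_integral_moveDensity_mul hpr hq hd hv).add ((measurable_rej hpr hq hd).mul hv)

lemma lintegral_piPost (hpr : Measurable pr) (hd : Measurable d) {F : T → ℝ≥0∞}
    (hF : Measurable F) :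
    ∫⁻ θ, F θ ∂(piPost ν pr g d δ) = (ENNReal.ofReal (c ν pr g d δ))⁻¹ *
      ∫⁻ θ, ENNReal.ofReal (pr θ * L g d δ θ) * F θ ∂ν := by
  rw [piPost, lintegral_smul_measure, smul_eq_mul, lintegral_withDensity_eq_lintegral_mul _
    (hpr.fun_mul (measurable_L hd)).ennreal_ofReal hF]
  rfl

/-- Cauchy-Schwarz against a sub-probability density. -/
lemma sq_lintegral_mul_le {μ : Measure T} {k w : T → ℝ≥0∞} (hk : Measurable k)
    (hw : Measurable w) (hk1 : ∫⁻ t, k t ∂μ ≤ 1) :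
    (∫⁻ t, k t * w t ∂μ) ^ 2 ≤ ∫⁻ t, k t * w t ^ 2 ∂μ := by
  have hCS := ENNReal.lintegral_mul_le_Lp_mul_Lq (μ.withDensity k)
    (Real.HolderConjugate.two_two) hw.aemeasurable (aemeasurable_const (b := (1 : ℝ≥0∞)))
  simp only [Pi.mul_apply, mul_one, ENNReal.one_rpow, lintegral_const, one_mul,
    withDensity_apply _ MeasurableSet.univ, Measure.restrict_univ] at hCS
  have hCS' := hCS.trans (mul_le_of_le_one_right' (ENNReal.rpow_le_one hk1 (by norm_num)))
  have hw2 : Measurable fun t => w t ^ (2 : ℝ) := hw.pow_const _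
  rw [lintegral_withDensity_eq_lintegral_mul _ hk hw,
    lintegral_withDensity_eq_lintegral_mul _ hk hw2] at hCS'
  calc (∫⁻ t, k t * w t ∂μ) ^ 2 ≤ ((∫⁻ t, k t * w t ^ (2 : ℝ) ∂μ) ^ (1 / 2 : ℝ)) ^ 2 := by
        gcongr
        exact hCS'
    _ = ∫⁻ t, k t * w t ^ 2 ∂μ := by
        rw [← ENNReal.rpow_natCast, ← ENNReal.rpow_mul]
        norm_num

lemma memLp_two_iff_lintegral {μ : Measure T} {v : T → ℝ} (hv : Measurable v) :
    MemLp v 2 μ ↔ ∫⁻ θ, ‖v θ‖ₑ ^ 2 ∂μ < ∞ := by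
  rw [MemLp, and_iff_right hv.aestronglyMeasurable,
    eLpNorm_lt_top_iff_lintegral_rpow_enorm_lt_top two_ne_zero ENNReal.ofNat_ne_top]
  simp

lemma lintegral_sq_integral_moveDensity_mul_le [SFinite ν] (hpr : Measurable pr)
    (hpr0 : ∀ θ, 0 ≤ pr θ) (hq : Measurable fun p : T × T => q p.1 p.2)
    (hq0 : ∀ θ ϑ, 0 ≤ q θ ϑ) (hq1 : ∀ θ, ∫ ϑ, q θ ϑ ∂ν = 1) (hd : Measurable d)
    {v : T → ℝ} (hv : Measurable v) :
    ∫⁻ θ, ‖∫ ϑ, moveDensity g pr q d δ θ ϑ * v ϑ ∂ν‖ₑ ^ 2 ∂(piPost ν pr g d δ) ≤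
      ∫⁻ θ, ‖v θ‖ₑ ^ 2 ∂(piPost ν pr g d δ) := by
  set m := moveDensity g pr q d δ
  have hm : Measurable fun p : T × T => m p.1 p.2 := measurable_moveDensity hpr hq hd
  have hm_left (θ : T) : Measurable fun ϑ => ENNReal.ofReal (m θ ϑ) :=
    (hm.of_uncurry_left (f := m)).ennreal_ofReal
  have hv2 : Measurable fun θ => ‖v θ‖ₑ ^ 2 := hv.enorm.pow_const _
  have hL : Measurable (L g d δ) := measurable_L hd
  rw [lintegral_piPost hpr hd
    ((measurable_integral_moveDensity_mul hpr hq hd hv).enorm.pow_const _),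
    lintegral_piPost hpr hd hv2]
  gcongr (ENNReal.ofReal (c ν pr g d δ))⁻¹ * ?_
  calc ∫⁻ θ, ENNReal.ofReal (pr θ * L g d δ θ) * ‖∫ ϑ, m θ ϑ * v ϑ ∂ν‖ₑ ^ 2 ∂ν
      ≤ ∫⁻ θ, ENNReal.ofReal (pr θ * L g d δ θ) *
          ∫⁻ ϑ, ENNReal.ofReal (m θ ϑ) * ‖v ϑ‖ₑ ^ 2 ∂ν ∂ν := by
        gcongr with θ
        refine (pow_le_pow_left' (enorm_integral_le_lintegral_enorm _) 2).trans ?_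
        simp only [enorm_mul, Real.enorm_of_nonneg (moveDensity_nonneg hpr0 hq0 _ _), m]
        exact sq_lintegral_mul_le (hm_left θ) hv.enorm
          (lintegral_moveDensity_le hpr hpr0 hq hq0 hq1 hd θ)
    _ = ∫⁻ θ, ∫⁻ ϑ, ENNReal.ofReal (pr ϑ * L g d δ ϑ * m ϑ θ) * ‖v ϑ‖ₑ ^ 2 ∂ν ∂ν := by
        refine lintegral_congr fun θ => ?_
        rw [← lintegral_const_mul _ ((hm_left θ).fun_mul hv2)]
        refine lintegral_congr fun ϑ => ?_
        rw [← mul_assoc, ← ENNReal.ofReal_mul (mul_nonneg (hpr0 _) (L_nonneg _)),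
          detailed_balance hpr0 hq0]
    _ = ∫⁻ ϑ, ∫⁻ θ, ENNReal.ofReal (pr ϑ * L g d δ ϑ * m ϑ θ) * ‖v ϑ‖ₑ ^ 2 ∂ν ∂ν := by
        refine lintegral_lintegral_swap (Measurable.aemeasurable ?_)
        have hm' : Measurable fun p : T × T => m p.2 p.1 := hm.comp measurable_swap
        unfold Function.uncurry
        fun_prop
    _ ≤ ∫⁻ ϑ, ENNReal.ofReal (pr ϑ * L g d δ ϑ) * ‖v ϑ‖ₑ ^ 2 ∂ν := by
        gcongr with ϑ
        simp only [ENNReal.ofReal_mul (mul_nonneg (hpr0 _) (L_nonneg _))]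
        rw [lintegral_mul_const _ ((hm_left ϑ).const_mul _), lintegral_const_mul _ (hm_left ϑ),
          mul_right_comm]
        exact mul_le_of_le_one_right' (lintegral_moveDensity_le hpr hpr0 hq hq0 hq1 hd ϑ)

lemma memLp_Pdotop [SFinite ν] (hpr : Measurable pr) (hpr0 : ∀ θ, 0 ≤ pr θ)
    (hq : Measurable fun p : T × T => q p.1 p.2) (hq0 : ∀ θ ϑ, 0 ≤ q θ ϑ)
    (hq1 : ∀ θ, ∫ ϑ, q θ ϑ ∂ν = 1) (hd : Measurable d) {v : T → ℝ} (hv : Measurable v)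
    (hv2 : MemLp v 2 (piPost ν pr g d δ)) :
    MemLp (Pdotop ν g pr q d δ v) 2 (piPost ν pr g d δ) := by
  refine MemLp.add (f := fun θ => ∫ ϑ, moveDensity g pr q d δ θ ϑ * v ϑ ∂ν)
    (g := fun θ => rej ν g pr q d δ θ * v θ) ?_ ?_
  · rw [memLp_two_iff_lintegral (measurable_integral_moveDensity_mul hpr hq hd hv)]
    exact (lintegral_sq_integral_moveDensity_mul_le hpr hpr0 hq hq0 hq1 hd hv).trans_lt
      ((memLp_two_iff_lintegral hv).1 hv2)
  · refine hv2.of_le ((measurable_rej hpr hq hd).mul hv).aestronglyMeasurable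
      (.of_forall fun θ => ?_)
    rw [norm_mul, Real.norm_of_nonneg (rej_nonneg hpr hpr0 hq hq0 hq1 hd θ)]
    exact mul_le_of_le_one_left (norm_nonneg _) (rej_le_one hpr0 hq0 θ)

lemma memLp_Pdotop_iterate [SFinite ν] (hpr : Measurable pr) (hpr0 : ∀ θ, 0 ≤ pr θ)
    (hq : Measurable fun p : T × T => q p.1 p.2) (hq0 : ∀ θ ϑ, 0 ≤ q θ ϑ)
    (hq1 : ∀ θ, ∫ ϑ, q θ ϑ ∂ν = 1) (hd : Measurable d) {v : T → ℝ} (hv : Measurable v)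
    (hv2 : MemLp v 2 (piPost ν pr g d δ)) (k : ℕ) :
    Measurable ((Pdotop ν g pr q d δ)^[k] v) ∧
      MemLp ((Pdotop ν g pr q d δ)^[k] v) 2 (piPost ν pr g d δ) := by
  induction k with
  | zero => exact ⟨hv, hv2⟩
  | succ k ih =>
    rw [Function.iterate_succ_apply']
    exact ⟨measurable_Pdotop hpr hq hd ih.1,
      memLp_Pdotop hpr hpr0 hq hq0 hq1 hd ih.1 ih.2⟩

/-- The marginal chain maps almost everywhere constant functions to themselves. -/
lemma Pdotop_ae_const (hpr : Measurable pr) (hpr0 : ∀ θ, 0 ≤ pr θ) (hd : Measurable d)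
    {v : T → ℝ} {a : ℝ} (hv : v =ᵐ[piPost ν pr g d δ] fun _ => a) :
    Pdotop ν g pr q d δ v =ᵐ[piPost ν pr g d δ] fun _ => a := by
  have hν : ∀ᵐ ϑ ∂ν, ENNReal.ofReal (pr ϑ * L g d δ ϑ) ≠ 0 → v ϑ = a := by
    rw [← ae_withDensity_iff (hpr.fun_mul (measurable_L hd)).ennreal_ofReal]
    exact (Measure.ae_ennreal_smul_measure_iff
      (ENNReal.inv_ne_zero.2 ENNReal.ofReal_ne_top)).1 hv
  filter_upwards [hv] with θ hθ
  have hint : ∫ ϑ, moveDensity g pr q d δ θ ϑ * v ϑ ∂ν =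
      ∫ ϑ, moveDensity g pr q d δ θ ϑ * a ∂ν := by
    refine integral_congr_ae ?_
    filter_upwards [hν] with ϑ hϑ
    by_cases h0 : ENNReal.ofReal (pr ϑ * L g d δ ϑ) = 0
    · have h0' := le_antisymm (ENNReal.ofReal_eq_zero.1 h0) (mul_nonneg (hpr0 ϑ) (L_nonneg ϑ))
      rw [moveDensity_eq_zero h0', zero_mul, zero_mul]
    · rw [hϑ h0]
  change (∫ ϑ, moveDensity g pr q d δ θ ϑ * v ϑ ∂ν) + _ = _
  rw [hint, integral_mul_const, integral_moveDensity_eq, hθ]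
  ring

lemma Pdotop_iterate_ae_const (hpr : Measurable pr) (hpr0 : ∀ θ, 0 ≤ pr θ) (hd : Measurable d)
    {v : T → ℝ} {a : ℝ} (hv : v =ᵐ[piPost ν pr g d δ] fun _ => a) (k : ℕ) :
    (Pdotop ν g pr q d δ)^[k] v =ᵐ[piPost ν pr g d δ] fun _ => a := by
  induction k with
  | zero => exact hv
  | succ k ih =>
    rw [Function.iterate_succ_apply']
    exact Pdotop_ae_const hpr hpr0 hd ih

end MetropolisHastings

section Autocovariance

variable {ν : Measure T} {pr : T → ℝ} {q : T → T → ℝ} {g : Kernel T Y} [IsMarkovKernel g]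
  {d : Y → ℝ} {δ ε : ℝ} {f : T → ℝ}

lemma integrable_wbar_mul_sq (hpr : Measurable pr) (hpr0 : ∀ θ, 0 ≤ pr θ) (hd : Measurable d)
    (h : ε ≤ δ) (hcδ : 0 < c ν pr g d δ) (hcε : 0 < c ν pr g d ε) (hf : Measurable f)
    (hf2 : ∫⁻ θ, ENNReal.ofReal ((f θ) ^ 2) ∂(piPost ν pr g d ε) < ⊤) :
    Integrable (fun θ => wbar g d δ ε θ * f θ ^ 2) (piPost ν pr g d δ) := by
  have h₁ : Integrable (fun θ => f θ ^ 2) (piPost ν pr g d ε) :=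
    (lintegral_ofReal_ne_top_iff_integrable (hf.pow_const 2).aestronglyMeasurable
      (.of_forall fun θ => sq_nonneg _)).1 hf2.ne
  rw [piPost, integrable_smul_measure (ENNReal.inv_ne_zero.2 ENNReal.ofReal_ne_top)
    (ENNReal.inv_ne_top.2 (by simpa using hcε)),
    ← integrable_smul_measure (c := (ENNReal.ofReal (c ν pr g d δ))⁻¹)
      (ENNReal.inv_ne_zero.2 ENNReal.ofReal_ne_top) (ENNReal.inv_ne_top.2 (by simpa using hcδ)),
    ← withDensity_wbar_piPost hpr hpr0 hd h,
    integrable_withDensity_iff_integrable_smul' (measurable_wbar hd).ennreal_ofReal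
      (by simp)] at h₁
  simpa only [ENNReal.toReal_ofReal, wbar_nonneg, smul_eq_mul] using h₁

lemma memLp_mul_wbar (hd : Measurable d) (h : ε ≤ δ) (hf : Measurable f)
    (hwf : Integrable (fun θ => wbar g d δ ε θ * f θ ^ 2) (piPost ν pr g d δ)) :
    MemLp (fun θ => f θ * wbar g d δ ε θ) 2 (piPost ν pr g d δ) := by
  have hm : Measurable fun θ => f θ * wbar g d δ ε θ := hf.mul (measurable_wbar hd)
  rw [memLp_two_iff_integrable_sq hm.aestronglyMeasurable]
  refine hwf.mono' (hm.pow_const 2).aestronglyMeasurable (.of_forall fun θ => ?_)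
  rw [Real.norm_of_nonneg (sq_nonneg _)]
  nlinarith [mul_nonneg (mul_nonneg (wbar_nonneg (g := g) (d := d) (δ := δ) (ε := ε) θ)
    (sub_nonneg.2 (wbar_le_one (g := g) hd h θ))) (sq_nonneg (f θ))]

lemma integrable_wbar_mul_one_sub (hd : Measurable d) (h : ε ≤ δ) (hf : Measurable f)
    (hwf : Integrable (fun θ => wbar g d δ ε θ * f θ ^ 2) (piPost ν pr g d δ)) :
    Integrable (fun θ => wbar g d δ ε θ * (1 - wbar g d δ ε θ) * f θ ^ 2)
      (piPost ν pr g d δ) :=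
  (hwf.sub (memLp_mul_wbar hd h hf hwf).integrable_sq).congr (.of_forall fun θ => by
    simp only [Pi.sub_apply]; ring)

lemma wbar_mul_one_sub_nonneg (hd : Measurable d) (h : ε ≤ δ) (θ : T) :
    0 ≤ wbar g d δ ε θ * (1 - wbar g d δ ε θ) * f θ ^ 2 :=
  mul_nonneg (mul_nonneg (wbar_nonneg θ) (sub_nonneg.2 (wbar_le_one hd h θ))) (sq_nonneg _)

lemma memLp_K_mul [SFinite ν] (hpr : Measurable pr) (hpr0 : ∀ θ, 0 ≤ pr θ) (hd : Measurable d)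
    (h : ε ≤ δ) (hf : Measurable f)
    (hwf : Integrable (fun θ => wbar g d δ ε θ * f θ ^ 2) (piPost ν pr g d δ)) :
    MemLp (fun p : T × Y => K d ε p.2 * f p.1) 2 (piJoint ν pr g d δ) := by
  rw [memLp_two_iff_integrable_sq
    ((measurable_K_snd hd).fun_mul (hf.fun_comp measurable_fst)).aestronglyMeasurable]
  refine ((integrable_K_mul_piJoint_iff hpr hpr0 hd h (hf.pow_const 2)).2 hwf).congr
    (.of_forall fun p => ?_)
  rcases K_eq_zero_or_one (d := d) (ε := ε) p.2 with hK | hK <;> simp [hK]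

lemma integrable_rej_pow_mul [SFinite ν] (hpr : Measurable pr) (hpr0 : ∀ θ, 0 ≤ pr θ)
    (hq : Measurable fun p : T × T => q p.1 p.2) (hq0 : ∀ θ ϑ, 0 ≤ q θ ϑ)
    (hq1 : ∀ θ, ∫ ϑ, q θ ϑ ∂ν = 1) (hd : Measurable d) {G : T → ℝ}
    (hG : Integrable G (piPost ν pr g d δ)) (k : ℕ) :
    Integrable (fun θ => rej ν g pr q d δ θ ^ k * G θ) (piPost ν pr g d δ) := by
  refine hG.bdd_mul (c := 1) ((measurable_rej hpr hq hd).pow_const k).aestronglyMeasurable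
    (.of_forall fun θ => ?_)
  have h0 := rej_nonneg (g := g) (δ := δ) hpr hpr0 hq hq0 hq1 hd θ
  rw [Real.norm_of_nonneg (pow_nonneg h0 k)]
  exact pow_le_one₀ h0 (rej_le_one hpr0 hq0 θ)

/-- The lag-`k` cross moment of the joint chain splits into that of the marginal chain and a
rejection term. -/
lemma integral_K_mul_MHop_iterate [SFinite ν] (hpr : Measurable pr) (hpr0 : ∀ θ, 0 ≤ pr θ)
    (hq : Measurable fun p : T × T => q p.1 p.2) (hq0 : ∀ θ ϑ, 0 ≤ q θ ϑ)
    (hq1 : ∀ θ, ∫ ϑ, q θ ϑ ∂ν = 1) (hd : Measurable d) (h : ε ≤ δ) (hf : Measurable f)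
    (hwf : Integrable (fun θ => wbar g d δ ε θ * f θ ^ 2) (piPost ν pr g d δ)) (k : ℕ) :
    ∫ p, (K d ε p.2 * f p.1) *
        ((MHop ν g pr q d δ)^[k] (fun p' => K d ε p'.2 * f p'.1)) p ∂(piJoint ν pr g d δ) =
      (∫ θ, (f θ * wbar g d δ ε θ) *
        ((Pdotop ν g pr q d δ)^[k] (fun ϑ => f ϑ * wbar g d δ ε ϑ)) θ ∂(piPost ν pr g d δ)) +
      ∫ θ, rej ν g pr q d δ θ ^ k * (wbar g d δ ε θ * (1 - wbar g d δ ε θ) * f θ ^ 2)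
        ∂(piPost ν pr g d δ) := by
  have hw : Measurable (wbar g d δ ε) := measurable_wbar hd
  have hr : Measurable (rej ν g pr q d δ) := measurable_rej hpr hq hd
  have hfw := memLp_mul_wbar hd h hf hwf
  obtain ⟨hPm, hP⟩ := memLp_Pdotop_iterate (q := q) hpr hpr0 hq hq0 hq1 hd (hf.fun_mul hw) hfw k
  set P := (Pdotop ν g pr q d δ)^[k] (fun ϑ => f ϑ * wbar g d δ ε ϑ)
  have hG : Measurable fun θ => f θ * P θ +
      rej ν g pr q d δ θ ^ k * ((1 - wbar g d δ ε θ) * f θ ^ 2) := by fun_prop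
  calc _ = ∫ p, K d ε p.2 * (fun θ => f θ * P θ +
          rej ν g pr q d δ θ ^ k * ((1 - wbar g d δ ε θ) * f θ ^ 2)) p.1
          ∂(piJoint ν pr g d δ) := by
        refine integral_congr_ae (.of_forall fun p => ?_)
        rcases K_eq_zero_or_one (d := d) (ε := ε) p.2 with hK | hK
        · simp [hK]
        · have hKδ : K d δ p.2 = 1 := by simpa [hK] using K_mul_K (d := d) h p.2
          simp only [MHop_iterate hd h f k hKδ, hK, P]
          ring
    _ = ∫ θ, wbar g d δ ε θ * (f θ * P θ +
          rej ν g pr q d δ θ ^ k * ((1 - wbar g d δ ε θ) * f θ ^ 2)) ∂(piPost ν pr g d δ) :=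
        integral_K_mul_piJoint hpr hpr0 hd h hG
    _ = _ := by
        rw [← integral_add (f := fun θ => f θ * wbar g d δ ε θ * P θ) (hfw.integrable_mul hP)
          (integrable_rej_pow_mul hpr hpr0 hq hq0 hq1 hd
            (integrable_wbar_mul_one_sub hd h hf hwf) k)]
        refine integral_congr_ae (.of_forall fun θ => ?_)
        ring

/-- Autocovariances of the marginal chain vanish when the marginal variance does. -/
lemma autocovariance_eq_zero (hpr : Measurable pr) (hpr0 : ∀ θ, 0 ≤ pr θ) (hd : Measurable d)
    (hc : 0 < c ν pr g d δ) {v : T → ℝ} (hv : MemLp v 2 (piPost ν pr g d δ))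
    (hvar : variance v (piPost ν pr g d δ) = 0) (k : ℕ) :
    (∫ θ, v θ * ((Pdotop ν g pr q d δ)^[k] v) θ ∂(piPost ν pr g d δ)) -
      (∫ θ, v θ ∂(piPost ν pr g d δ)) ^ 2 = 0 := by
  have := isProbabilityMeasure_piPost (g := g) (ν := ν) hpr0 hc
  have hconst : v =ᵐ[piPost ν pr g d δ] fun _ => ∫ θ, v θ ∂(piPost ν pr g d δ) := by
    rw [← evariance_eq_zero_iff hv.aemeasurable, ← hv.ofReal_variance_eq, hvar,
      ENNReal.ofReal_zero]
  have hprod : (fun θ => v θ * ((Pdotop ν g pr q d δ)^[k] v) θ) =ᵐ[piPost ν pr g d δ]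
      fun _ => (∫ θ, v θ ∂(piPost ν pr g d δ)) ^ 2 := by
    filter_upwards [hconst, Pdotop_iterate_ae_const (q := q) hpr hpr0 hd hconst k] with θ h₁ h₂
    rw [h₂, h₁, sq]
  rw [integral_congr_ae hprod]
  simp

end Autocovariance

end ABCsimple

open ABCsimple

/-- Theorem 2 of the paper: integrated autocorrelation formula for
the simple cut-off. -/
theorem stmt5 {T Y : Type*} [MeasurableSpace T] [MeasurableSpace Y]
    (ν : Measure T) [SigmaFinite ν]
    (pr : T → ℝ) (hpr_meas : Measurable pr) (hpr_nonneg : ∀ θ, 0 ≤ pr θ)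
    (hpr_prob : ∫ θ, pr θ ∂ν = 1)
    (g : Kernel T Y) [IsMarkovKernel g]
    (d : Y → ℝ) (hd_meas : Measurable d) (hd_nonneg : ∀ y, 0 ≤ d y)
    (q : T → T → ℝ) (hq_meas : Measurable (fun p : T × T => q p.1 p.2))
    (hq_nonneg : ∀ θ ϑ, 0 ≤ q θ ϑ) (hq_prob : ∀ θ, ∫ ϑ, q θ ϑ ∂ν = 1)
    (ε δ : ℝ) (hε : 0 < ε) (hεδ : ε ≤ δ)
    (hcδ : 0 < c ν pr g d δ) (hcε : 0 < c ν pr g d ε)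
    (f : T → ℝ) (hf_meas : Measurable f)
    (hf2 : ∫⁻ θ, ENNReal.ofReal ((f θ) ^ 2) ∂(piPost ν pr g d ε) < ⊤)
    -- lag-k autocorrelations of `h(Θ,Y) = 1{d(Y,y*) ≤ ε} f(Θ)` for the stationary chain
    (ρ : ℕ → ℝ)
    (hρ : ∀ k : ℕ, ρ k =
      ((∫ p, (K d ε p.2 * f p.1) *
            ((MHop ν g pr q d δ)^[k] (fun p' => K d ε p'.2 * f p'.1)) p
            ∂(piJoint ν pr g d δ))
          - (∫ p, K d ε p.2 * f p.1 ∂(piJoint ν pr g d δ)) ^ 2) /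
        variance (fun p : T × Y => K d ε p.2 * f p.1) (piJoint ν pr g d δ))
    -- lag-k autocorrelations of `f_w(Θ) = f(Θ) w̄(Θ)` for the stationary marginal chain
    (ρcheck : ℕ → ℝ)
    (hρcheck : ∀ k : ℕ, ρcheck k =
      ((∫ θ, (f θ * wbar g d δ ε θ) *
            ((Pdotop ν g pr q d δ)^[k] (fun ϑ => f ϑ * wbar g d δ ε ϑ)) θ
            ∂(piPost ν pr g d δ))
          - (∫ θ, f θ * wbar g d δ ε θ ∂(piPost ν pr g d δ)) ^ 2) /
        variance (fun θ => f θ * wbar g d δ ε θ) (piPost ν pr g d δ))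
    (hvar : 0 < variance (fun p : T × Y => K d ε p.2 * f p.1) (piJoint ν pr g d δ))
    (hsum : Summable (fun k : ℕ => |ρ (k + 1)|))
    (hsumcheck : Summable (fun k : ℕ => |ρcheck (k + 1)|))
    (hrej : ∀ᵐ θ ∂(piPost ν pr g d δ), rej ν g pr q d δ θ < 1)
    (hint : Integrable
      (fun θ => wbar g d δ ε θ * (1 - wbar g d δ ε θ) *
        (rej ν g pr q d δ θ / (1 - rej ν g pr q d δ θ)) * (f θ) ^ 2)
      (piPost ν pr g d δ)) :
    (1 + 2 * ∑' k : ℕ, ρ (k + 1)) - 1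
      = (((1 + 2 * ∑' k : ℕ, ρcheck (k + 1)) - 1) *
            variance (fun θ => f θ * wbar g d δ ε θ) (piPost ν pr g d δ)
          + 2 * ∫ θ, wbar g d δ ε θ * (1 - wbar g d δ ε θ) *
              (rej ν g pr q d δ θ / (1 - rej ν g pr q d δ θ)) * (f θ) ^ 2
              ∂(piPost ν pr g d δ)) /
        (variance (fun θ => f θ * wbar g d δ ε θ) (piPost ν pr g d δ)
          + ∫ θ, wbar g d δ ε θ * (1 - wbar g d δ ε θ) * (f θ) ^ 2
              ∂(piPost ν pr g d δ)) := by
  set π := piPost ν pr g d δ with hπ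
  have hπ_prob : IsProbabilityMeasure π := isProbabilityMeasure_piPost hpr_nonneg hcδ
  have hJ_prob : IsProbabilityMeasure (piJoint ν pr g d δ) :=
    isProbabilityMeasure_piJoint hpr_meas hpr_nonneg hd_meas hcδ
  have hwf := integrable_wbar_mul_sq hpr_meas hpr_nonneg hd_meas hεδ hcδ hcε hf_meas hf2
  have hfw := memLp_mul_wbar hd_meas hεδ hf_meas hwf
  have hV := integrable_wbar_mul_one_sub hd_meas hεδ hf_meas hwf
  have hcross := integral_K_mul_MHop_iterate hpr_meas hpr_nonneg hq_meas hq_nonneg hq_prob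
    hd_meas hεδ hf_meas hwf
  have hmean : ∫ p, K d ε p.2 * f p.1 ∂(piJoint ν pr g d δ) =
      ∫ θ, f θ * wbar g d δ ε θ ∂π := by
    rw [integral_K_mul_piJoint hpr_meas hpr_nonneg hd_meas hεδ hf_meas]
    simp only [mul_comm, hπ]
  set D : ℕ → ℝ := fun k => ∫ θ, rej ν g pr q d δ θ ^ k *
    (wbar g d δ ε θ * (1 - wbar g d δ ε θ) * f θ ^ 2) ∂π with hD
  have hvar_joint : variance (fun p : T × Y => K d ε p.2 * f p.1) (piJoint ν pr g d δ) =
      variance (fun θ => f θ * wbar g d δ ε θ) π +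
        ∫ θ, wbar g d δ ε θ * (1 - wbar g d δ ε θ) * (f θ) ^ 2 ∂π := by
    rw [variance_eq_sub (memLp_K_mul hpr_meas hpr_nonneg hd_meas hεδ hf_meas hwf),
      variance_eq_sub hfw, hmean]
    have h0 := hcross 0
    simp only [Function.iterate_zero, id_eq, pow_zero, one_mul] at h0
    simp only [Pi.pow_apply, sq (_ * _)]
    rw [h0]
    ring
  have hcheck : ∀ k, ρcheck k * variance (fun θ => f θ * wbar g d δ ε θ) π =
      (∫ θ, (f θ * wbar g d δ ε θ) *
        ((Pdotop ν g pr q d δ)^[k] (fun ϑ => f ϑ * wbar g d δ ε ϑ)) θ ∂π) -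
          (∫ θ, f θ * wbar g d δ ε θ ∂π) ^ 2 := fun k => by
    rcases eq_or_ne (variance (fun θ => f θ * wbar g d δ ε θ) π) 0 with h0 | h0
    · rw [h0, mul_zero, autocovariance_eq_zero hpr_meas hpr_nonneg hd_meas hcδ hfw h0]
    · rw [hρcheck k, div_mul_cancel₀ _ h0]
  have hD_eq : ∀ k, D k =
      ρ k * variance (fun p : T × Y => K d ε p.2 * f p.1) (piJoint ν pr g d δ) -
        ρcheck k * variance (fun θ => f θ * wbar g d δ ε θ) π := fun k => by
    rw [hcheck, hρ k, div_mul_cancel₀ _ hvar.ne', hcross k, hmean]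
    ring
  have hD_sum : HasSum (fun k => D (k + 1))
      ((∑' k, ρ (k + 1)) *
        variance (fun p : T × Y => K d ε p.2 * f p.1) (piJoint ν pr g d δ) -
      (∑' k, ρcheck (k + 1)) * variance (fun θ => f θ * wbar g d δ ε θ) π) := by
    simp only [hD_eq]
    exact (hsum.of_abs.hasSum.mul_right _).sub (hsumcheck.of_abs.hasSum.mul_right _)
  have hr0 := rej_nonneg (g := g) (δ := δ) hpr_meas hpr_nonneg hq_meas hq_nonneg hq_prob hd_meas
  have hD_sum' := hasSum_integral_of_summable_integral_norm (μ := π)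
    (F := fun (k : ℕ) θ => rej ν g pr q d δ θ ^ (k + 1) *
      (wbar g d δ ε θ * (1 - wbar g d δ ε θ) * f θ ^ 2))
    (fun k => integrable_rej_pow_mul hpr_meas hpr_nonneg hq_meas hq_nonneg hq_prob hd_meas hV _)
    (hD_sum.summable.congr fun k => integral_congr_ae (.of_forall fun θ =>
      (Real.norm_of_nonneg (mul_nonneg (pow_nonneg (hr0 θ) _)
        (wbar_mul_one_sub_nonneg hd_meas hεδ θ))).symm))
  have hgeom : ∫ θ, (∑' k : ℕ, rej ν g pr q d δ θ ^ (k + 1) *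
        (wbar g d δ ε θ * (1 - wbar g d δ ε θ) * f θ ^ 2)) ∂π =
      ∫ θ, wbar g d δ ε θ * (1 - wbar g d δ ε θ) *
        (rej ν g pr q d δ θ / (1 - rej ν g pr q d δ θ)) * (f θ) ^ 2 ∂π := by
    refine integral_congr_ae ?_
    filter_upwards [hrej] with θ hθ
    simp only [pow_succ]
    rw [tsum_mul_right, tsum_mul_right, tsum_geometric_of_lt_one (hr0 θ) hθ]
    ring
  have hkey := hD_sum.unique hD_sum'
  rw [hgeom] at hkey
  rw [← hvar_joint, eq_div_iff hvar.ne', ← hkey]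
  ring
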